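/- Let N_a, N_b be natural numbers, let A be an N_a × N_b real matrix (the aggregation matrix), let P_b be a probability measure on ℝ^{N_b} (the bottom-level forecast distribution), and let S : ℝ^{N_b} → ℝ^{N_a} × ℝ^{N_b} be given by S(y) = (A·y, y). Let Q be any probability measure on ℝ^{N_a} × ℝ^{N_b} such that: (i) the second marginal of Q equals P_b, i.e., (Prod.snd)_* Q = P_b, and (ii) Q assigns zero probability to incoherent outcomes, i.e., Q({(y_a, y_b) : y_a ≠ A·y_b}) = 0. Then Q is probabilistically coherent: for every Borel-measurable set B ⊆ ℝ^{N_b}, Q(S(B)) = P_b(B). -/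

import Mathlib

open MeasureTheory

/-- If a joint forecast distribution `Q` on ℝ^{N_a} × ℝ^{N_b} has
second marginal `P_b` and assigns zero probability to incoherent outcomes
`{(y_a, y_b) : y_a ≠ A·y_b}`, then `Q` is probabilistically coherent:
`Q(S(B)) = P_b(B)` for every Borel set `B`, where `S(y) = (A·y, y)`. -/
theorem zero_incoherent_implies_coherent
    (Na Nb : ℕ) (A : Matrix (Fin Na) (Fin Nb) ℝ)
    (Pb : Measure (Fin Nb → ℝ)) [IsProbabilityMeasure Pb]
    (Q : Measure ((Fin Na → ℝ) × (Fin Nb → ℝ))) [IsProbabilityMeasure Q]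
    (hsnd : Q.map Prod.snd = Pb)
    (hzero : Q {p : (Fin Na → ℝ) × (Fin Nb → ℝ) | p.1 ≠ A.mulVec p.2} = 0) :
    ∀ B : Set (Fin Nb → ℝ), MeasurableSet B →
      Q ((fun y : Fin Nb → ℝ => (A.mulVec y, y)) '' B) = Pb B := by
  intro B hB
  rw [← hsnd, Measure.map_apply measurable_snd hB]
  refine measure_congr (Filter.eventuallyEq_set.mpr ?_)
  have hcoh : ∀ᵐ p ∂Q, p.1 = A.mulVec p.2 := ae_iff.mpr hzero
  filter_upwards [hcoh] with p hp
  constructor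
  · rintro ⟨y, hy, rfl⟩
    exact hy
  · exact fun hpB => ⟨p.2, hpB, Prod.ext hp.symm rfl⟩
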